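/- There is an absolute constant C such that for all K, P ≥ 1/2, ∫_ℝ ∫₀^π (sinh²r + sin²ω)·k(r)·θ(ω) dω dr ≤ C·(1/K² + 1/P²). -/

import Mathlib

open scoped Real
open Complex

/-- `k(r) = √π K exp(−K²r²)`. -/
noncomputable def kfun (K r : ℝ) : ℝ := Real.sqrt Real.pi * K * Real.exp (-(K ^ 2 * r ^ 2))

/-- `θ(ω) = √π P Σ_{q∈ℤ} exp(−P²(ω+πq)²)`. -/
noncomputable def thetafun (P ω : ℝ) : ℝ :=
  Real.sqrt Real.pi * P * ∑' q : ℤ, Real.exp (-(P ^ 2 * (ω + Real.pi * q) ^ 2))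

open MeasureTheory in
lemma aux_gauss (b : ℝ) (hb : 0 < b) :
    Integrable (fun x : ℝ => Real.exp (-(b ^ 2 * x ^ 2))) ∧
    ∫ x : ℝ, Real.exp (-(b ^ 2 * x ^ 2)) = Real.sqrt Real.pi / b := by
  constructor
  · have := integrable_exp_neg_mul_sq (b := b ^ 2) (by positivity)
    simpa [neg_mul] using this
  · have := integral_gaussian (b ^ 2)
    rw [Real.sqrt_div Real.pi_pos.le, Real.sqrt_sq hb.le] at this
    simpa [neg_mul] using this

open MeasureTheory in
lemma aux_shift (b : ℝ) (hb : 0 < b) (s : ℝ) (hs : s ^ 2 = 1) :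
    Integrable (fun x : ℝ => Real.exp (2 * s * x) * Real.exp (-(b ^ 2 * x ^ 2))) ∧
    ∫ x : ℝ, Real.exp (2 * s * x) * Real.exp (-(b ^ 2 * x ^ 2))
      = Real.exp (1 / b ^ 2) * (Real.sqrt Real.pi / b) := by
  have h : (fun x : ℝ => Real.exp (2 * s * x) * Real.exp (-(b ^ 2 * x ^ 2)))
      = fun x => Real.exp (1 / b ^ 2) * Real.exp (-(b ^ 2 * (x - s / b ^ 2) ^ 2)) := by
    funext x
    rw [← Real.exp_add, ← Real.exp_add]
    congr 1
    field_simp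
    linear_combination hs
  obtain ⟨h1, h2⟩ := aux_gauss b hb
  rw [h]
  constructor
  · exact (h1.comp_sub_right (s / b ^ 2)).const_mul _
  · rw [integral_const_mul, integral_sub_right_eq_self
      (fun x : ℝ => Real.exp (-(b ^ 2 * x ^ 2))), h2]

open MeasureTheory in
lemma aux_sinh (b : ℝ) (hb : 0 < b) :
    Integrable (fun x : ℝ => Real.sinh x ^ 2 * Real.exp (-(b ^ 2 * x ^ 2))) ∧
    ∫ x : ℝ, Real.sinh x ^ 2 * Real.exp (-(b ^ 2 * x ^ 2))
      = (Real.exp (1 / b ^ 2) - 1) / 2 * (Real.sqrt Real.pi / b) := by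
  obtain ⟨h1, h2⟩ := aux_gauss b hb
  obtain ⟨p1, p2⟩ := aux_shift b hb 1 (by norm_num)
  obtain ⟨m1, m2⟩ := aux_shift b hb (-1) (by norm_num)
  have h : (fun x : ℝ => Real.sinh x ^ 2 * Real.exp (-(b ^ 2 * x ^ 2)))
      = fun x => (1/4) * (Real.exp (2 * 1 * x) * Real.exp (-(b ^ 2 * x ^ 2)) +
        Real.exp (2 * (-1) * x) * Real.exp (-(b ^ 2 * x ^ 2))) -
        (1/2) * Real.exp (-(b ^ 2 * x ^ 2)) := by
    funext x
    have e1 : Real.exp (2 * 1 * x) = Real.exp x ^ 2 := by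
      rw [← Real.exp_nat_mul]; congr 1; push_cast; ring
    have e2 : Real.exp (2 * (-1) * x) = Real.exp (-x) ^ 2 := by
      rw [← Real.exp_nat_mul]; congr 1; push_cast; ring
    have e3 : Real.exp x * Real.exp (-x) = 1 := by rw [← Real.exp_add]; simp
    rw [e1, e2, Real.sinh_eq]
    linear_combination (-1/2) * Real.exp (-(b ^ 2 * x ^ 2)) * e3
  rw [h]
  constructor
  · exact ((p1.add m1).const_mul _).sub (h1.const_mul _)
  · rw [integral_sub (f := fun x => (1/4) * (Real.exp (2 * 1 * x) * Real.exp (-(b ^ 2 * x ^ 2)) +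
        Real.exp (2 * (-1) * x) * Real.exp (-(b ^ 2 * x ^ 2))))
        ((p1.add m1).const_mul _) (h1.const_mul _), integral_const_mul, integral_const_mul,
        integral_add p1 m1, h2, p2, m2]
    ring

open MeasureTheory in
lemma aux_sin (b : ℝ) (hb : 0 < b) :
    Integrable (fun x : ℝ => Real.sin x ^ 2 * Real.exp (-(b ^ 2 * x ^ 2))) ∧
    ∫ x : ℝ, Real.sin x ^ 2 * Real.exp (-(b ^ 2 * x ^ 2))
      ≤ (Real.exp (1 / b ^ 2) - 1) / 2 * (Real.sqrt Real.pi / b) := by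
  obtain ⟨h1, h2⟩ := aux_sinh b hb
  have key : ∀ x : ℝ, Real.sin x ^ 2 ≤ Real.sinh x ^ 2 := by
    intro x
    rw [sq_le_sq]
    refine (Real.abs_sin_le_abs (x := x)).trans ?_
    rcases le_total 0 x with hx | hx
    · rw [abs_of_nonneg hx, abs_of_nonneg (Real.sinh_nonneg_iff.2 hx)]
      exact Real.self_le_sinh_iff.2 hx
    · rw [abs_of_nonpos hx, abs_of_nonpos (Real.sinh_nonpos_iff.2 hx)]
      linarith [Real.sinh_le_self_iff.2 hx]
  have hi : Integrable (fun x : ℝ => Real.sin x ^ 2 * Real.exp (-(b ^ 2 * x ^ 2))) := by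
    refine h1.mono' (by fun_prop) (Filter.Eventually.of_forall fun x => ?_)
    rw [Real.norm_of_nonneg (by positivity)]
    exact mul_le_mul_of_nonneg_right (key x) (Real.exp_pos _).le
  refine ⟨hi, ?_⟩
  rw [← h2]
  exact integral_mono hi h1 fun x => mul_le_mul_of_nonneg_right (key x) (Real.exp_pos _).le

open MeasureTheory in
lemma aux_unfold (g : ℝ → ℝ) (hg : Integrable g) (h0 : ∀ x, 0 ≤ g x) :
    ∫ ω in (0:ℝ)..Real.pi, ∑' q : ℤ, g (ω + Real.pi * q) = ∫ x, g x := by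
  have hpi := Real.pi_pos
  have hg' : Integrable (fun t => g (Real.pi * t)) := hg.comp_mul_left' hpi.ne'
  have hs := (hg'.hasSum_intervalIntegral 0).mul_left Real.pi
  have e : ∀ q : ℤ, Real.pi * ∫ t in (0 + (q:ℝ))..(0 + (q:ℝ) + 1), g (Real.pi * t)
      = ∫ ω in (0:ℝ)..Real.pi, g (ω + Real.pi * q) := by
    intro q
    rw [intervalIntegral.integral_comp_add_right, intervalIntegral.integral_comp_mul_left _ hpi.ne',
      smul_eq_mul, mul_inv_cancel_left₀ hpi.ne']
    congr 1 <;> ring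
  have e2 : Real.pi * ∫ t, g (Real.pi * t) = ∫ x, g x := by
    rw [Measure.integral_comp_mul_left, smul_eq_mul, abs_of_pos (by positivity),
      mul_inv_cancel_left₀ hpi.ne']
  simp only [e, e2] at hs
  have hF : HasSum (fun q : ℤ => ∫ ω in Set.Ioc 0 Real.pi, g (ω + Real.pi * q))
      (∫ ω in Set.Ioc 0 Real.pi, ∑' q : ℤ, g (ω + Real.pi * q)) := by
    apply hasSum_integral_of_summable_integral_norm
    · intro q
      exact (hg.comp_add_right _).integrableOn
    · simp only [Real.norm_of_nonneg (h0 _)]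
      simpa only [intervalIntegral.integral_of_le hpi.le] using hs.summable
  simp only [intervalIntegral.integral_of_le hpi.le] at hs ⊢
  exact hF.unique hs

lemma aux_inner (K P r : ℝ) (hP : 0 < P) :
    (∫ ω in (0:ℝ)..Real.pi, (Real.sinh r ^ 2 + Real.sin ω ^ 2) * kfun K r * thetafun P ω)
    = Real.pi * Real.sqrt Real.pi * K * (Real.sinh r ^ 2 * Real.exp (-(K ^ 2 * r ^ 2)))
      + Real.pi * K * P * (∫ x : ℝ, Real.sin x ^ 2 * Real.exp (-(P ^ 2 * x ^ 2))) *
        Real.exp (-(K ^ 2 * r ^ 2)) := by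
  obtain ⟨h1, h2⟩ := aux_gauss P hP
  obtain ⟨s1, -⟩ := aux_sin P hP
  have hsin : ∀ (x : ℝ) (q : ℤ), Real.sin (x + Real.pi * q) ^ 2 = Real.sin x ^ 2 := by
    intro x q
    rw [mul_comm, Real.sin_add_int_mul_pi, mul_pow, ← zpow_natCast, ← zpow_mul, mul_comm q,
      zpow_mul]
    simp
  have hi : ∀ ω : ℝ, (Real.sinh r ^ 2 + Real.sin ω ^ 2) * kfun K r * thetafun P ω
      = (kfun K r * (Real.sqrt Real.pi * P)) * ∑' q : ℤ,
        (fun x => Real.sinh r ^ 2 * Real.exp (-(P ^ 2 * x ^ 2)) +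
          Real.sin x ^ 2 * Real.exp (-(P ^ 2 * x ^ 2))) (ω + Real.pi * q) := by
    intro ω
    simp only [hsin, ← add_mul]
    rw [tsum_mul_left, thetafun]
    ring
  simp only [hi]
  rw [intervalIntegral.integral_const_mul, aux_unfold (fun x => Real.sinh r ^ 2 * Real.exp (-(P ^ 2 * x ^ 2)) +
          Real.sin x ^ 2 * Real.exp (-(P ^ 2 * x ^ 2))) ((h1.const_mul _).add s1)
    (fun x => by positivity), MeasureTheory.integral_add (h1.const_mul _) s1,
    MeasureTheory.integral_const_mul, h2, kfun]
  have hq : Real.sqrt Real.pi * Real.sqrt Real.pi = Real.pi := Real.mul_self_sqrt Real.pi_pos.le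
  generalize (∫ x : ℝ, Real.sin x ^ 2 * Real.exp (-(P ^ 2 * x ^ 2))) = J
  generalize Real.exp (-(K ^ 2 * r ^ 2)) = E
  generalize Real.sqrt Real.pi = w at *
  rw [← hq]
  field_simp

lemma aux_exp (b : ℝ) (hb : 1/2 ≤ b) : Real.exp (1 / b ^ 2) - 1 ≤ Real.exp 4 * (1 / b ^ 2) := by
  have hx : 1 / b ^ 2 ≤ 4 := by
    rw [div_le_iff₀ (by positivity)]; nlinarith
  have hx0 : 0 ≤ 1 / b ^ 2 := by positivity
  generalize 1 / b ^ 2 = x at *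
  have h1 := Real.add_one_le_exp (-x)
  have h2 : Real.exp x * Real.exp (-x) = 1 := by rw [← Real.exp_add]; simp
  have h3 : Real.exp x ≤ Real.exp 4 := Real.exp_le_exp.2 hx
  nlinarith [Real.exp_pos x]

/-- `∫_ℝ ∫₀^π (sinh²r + sin²ω) k(r) θ(ω) dω dr ≤ C (1/K² + 1/P²)`. -/
theorem weight_integral_bound_small :
    ∃ C : ℝ, ∀ K P : ℝ, 1/2 ≤ K → 1/2 ≤ P →
      (∫ r : ℝ, ∫ ω in (0:ℝ)..Real.pi,
          (Real.sinh r ^ 2 + Real.sin ω ^ 2) * kfun K r * thetafun P ω) ≤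
        C * (1 / K ^ 2 + 1 / P ^ 2) := by
  refine ⟨Real.pi ^ 2 / 2 * Real.exp 4, fun K P hK hP => ?_⟩
  have hK0 : 0 < K := by linarith
  have hP0 : 0 < P := by linarith
  simp only [aux_inner K P _ hP0]
  obtain ⟨h1, h2⟩ := aux_gauss K hK0
  obtain ⟨s1, s2⟩ := aux_sinh K hK0
  obtain ⟨-, j2⟩ := aux_sin P hP0
  rw [MeasureTheory.integral_add (s1.const_mul _) (h1.const_mul _),
    MeasureTheory.integral_const_mul, MeasureTheory.integral_const_mul, h2, s2]
  generalize (∫ x : ℝ, Real.sin x ^ 2 * Real.exp (-(P ^ 2 * x ^ 2))) = J at *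
  have hq : Real.sqrt Real.pi ^ 2 = Real.pi := Real.sq_sqrt Real.pi_pos.le
  have hpi := Real.pi_pos
  have a1 := aux_exp K hK
  have a2 := aux_exp P hP
  calc _ ≤ Real.pi * Real.sqrt Real.pi * K *
          ((Real.exp (1 / K ^ 2) - 1) / 2 * (Real.sqrt Real.pi / K)) +
        Real.pi * K * P * ((Real.exp (1 / P ^ 2) - 1) / 2 * (Real.sqrt Real.pi / P)) *
          (Real.sqrt Real.pi / K) := by gcongr
    _ = Real.pi ^ 2 / 2 * ((Real.exp (1 / K ^ 2) - 1) + (Real.exp (1 / P ^ 2) - 1)) := by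
      generalize Real.exp (1 / K ^ 2) = A
      generalize Real.exp (1 / P ^ 2) = B
      field_simp
      rw [hq]
    _ ≤ Real.pi ^ 2 / 2 * (Real.exp 4 * (1 / K ^ 2) + Real.exp 4 * (1 / P ^ 2)) := by gcongr
    _ = _ := by ring
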